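/- Let x be a random vector in ℝ^d with finite fourth moments and H := E[x xᵀ], let η > 0 satisfy η · λ_max(H) ≤ 1 (λ_max(H) the largest eigenvalue of H), let σ ≥ 0 and N ≥ 1, and define C₀ := 0 and C_{t+1} := E[(I − η x xᵀ) C_t (I − η x xᵀ)] + η² σ² H for t = 0,…,N−1. Then C_N ⪰ (η σ² / 2) · (I − (I − ηH)^{2N}). -/

import Mathlib

open MeasureTheory Matrix

/-- Entrywise expectation of a matrix-valued random variable. -/
noncomputable def expMatrix {Ω : Type*} [MeasurableSpace Ω] {d : ℕ}
    (μ : Measure Ω) (f : Ω → Matrix (Fin d) (Fin d) ℝ) : Matrix (Fin d) (Fin d) ℝ :=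
  Matrix.of fun i j => ∫ ω, f ω i j ∂μ


/-- Entrywise integrability. -/
def EntInt {Ω : Type*} [MeasurableSpace Ω] {d : ℕ}
    (μ : Measure Ω) (f : Ω → Matrix (Fin d) (Fin d) ℝ) : Prop :=
  ∀ i j, Integrable (fun ω => f ω i j) μ

section aux
variable {Ω : Type*} [MeasurableSpace Ω] {d : ℕ} {μ : Measure Ω}
  {f g : Ω → Matrix (Fin d) (Fin d) ℝ}

lemma EntInt.add' (hf : EntInt μ f) (hg : EntInt μ g) : EntInt μ (fun ω => f ω + g ω) :=
  fun i j => (hf i j).add (hg i j)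

lemma EntInt.sub' (hf : EntInt μ f) (hg : EntInt μ g) : EntInt μ (fun ω => f ω - g ω) :=
  fun i j => (hf i j).sub (hg i j)

lemma EntInt.smul' (c : ℝ) (hf : EntInt μ f) : EntInt μ (fun ω => c • f ω) :=
  fun i j => (hf i j).const_mul c

lemma EntInt.const [IsFiniteMeasure μ] (A : Matrix (Fin d) (Fin d) ℝ) :
    EntInt μ (fun _ => A) :=
  fun i j => integrable_const (A i j)

lemma EntInt.mulLeft (A : Matrix (Fin d) (Fin d) ℝ) (hf : EntInt μ f) :
    EntInt μ (fun ω => A * f ω) := by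
  intro i j
  simp only [Matrix.mul_apply]
  exact integrable_finsetSum _ fun k _ => (hf k j).const_mul _

lemma EntInt.mulRight (A : Matrix (Fin d) (Fin d) ℝ) (hf : EntInt μ f) :
    EntInt μ (fun ω => f ω * A) := by
  intro i j
  simp only [Matrix.mul_apply]
  exact integrable_finsetSum _ fun k _ => (hf i k).mul_const _

lemma exp_add (hf : EntInt μ f) (hg : EntInt μ g) :
    expMatrix μ (fun ω => f ω + g ω) = expMatrix μ f + expMatrix μ g := by
  ext i j
  exact integral_add (hf i j) (hg i j)

lemma exp_sub (hf : EntInt μ f) (hg : EntInt μ g) :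
    expMatrix μ (fun ω => f ω - g ω) = expMatrix μ f - expMatrix μ g := by
  ext i j
  exact integral_sub (hf i j) (hg i j)

lemma exp_smul (c : ℝ) :
    expMatrix μ (fun ω => c • f ω) = c • expMatrix μ f := by
  ext i j
  exact integral_const_mul c _

lemma exp_const [IsProbabilityMeasure μ] (A : Matrix (Fin d) (Fin d) ℝ) :
    expMatrix μ (fun _ => A) = A := by
  ext i j
  simp [expMatrix]

lemma exp_mulLeft (A : Matrix (Fin d) (Fin d) ℝ) (hf : EntInt μ f) :
    expMatrix μ (fun ω => A * f ω) = A * expMatrix μ f := by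
  ext i j
  simp only [expMatrix, Matrix.mul_apply, Matrix.of_apply]
  rw [integral_finsetSum _ fun k _ => (hf k j).const_mul _]
  simp only [integral_const_mul]

lemma exp_mulRight (A : Matrix (Fin d) (Fin d) ℝ) (hf : EntInt μ f) :
    expMatrix μ (fun ω => f ω * A) = expMatrix μ f * A := by
  ext i j
  simp only [expMatrix, Matrix.mul_apply, Matrix.of_apply]
  rw [integral_finsetSum _ fun k _ => (hf i k).mul_const _]
  simp only [integral_mul_const]

lemma exp_psd (hf : EntInt μ f) (hp : ∀ ω, (f ω).PosSemidef) :
    (expMatrix μ f).PosSemidef := by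
  refine Matrix.PosSemidef.of_dotProduct_mulVec_nonneg ?_ ?_
  · ext i j
    simp only [expMatrix, Matrix.conjTranspose_apply, Matrix.of_apply, star_trivial]
    congr 1
    ext ω
    simpa using (hp ω).isHermitian.apply i j
  · intro v
    have h : star v ⬝ᵥ (expMatrix μ f *ᵥ v) = ∫ ω, star v ⬝ᵥ (f ω *ᵥ v) ∂μ := by
      simp only [expMatrix, dotProduct, mulVec, Matrix.of_apply]
      rw [integral_finsetSum _ fun i _ =>
        (integrable_finsetSum _ fun k _ => (hf i k).mul_const _).const_mul _]
      refine Finset.sum_congr rfl fun i _ => ?_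
      rw [integral_const_mul, integral_finsetSum _ fun k _ => (hf i k).mul_const _]
      simp only [integral_mul_const]
    rw [h]
    exact integral_nonneg fun ω => (hp ω).dotProduct_mulVec_nonneg v

lemma abs_le_s (y : Fin d → ℝ) (i j : Fin d) : |y i * y j| ≤ ∑ i, y i ^ 2 := by
  have h (i : Fin d) : y i ^ 2 ≤ ∑ i, y i ^ 2 :=
    Finset.single_le_sum (f := fun i => y i ^ 2) (fun i _ => sq_nonneg _) (Finset.mem_univ i)
  have h1 := h i
  have h2 := h j
  rw [abs_le]
  constructor <;> nlinarith [sq_nonneg (y i - y j), sq_nonneg (y i + y j)]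

lemma entInt_X [IsFiniteMeasure μ] (x : Ω → Fin d → ℝ) (hmeas : Measurable x)
    (hx4 : Integrable (fun ω => (∑ i, x ω i ^ 2) ^ 2) μ) :
    EntInt μ (fun ω => vecMulVec (x ω) (x ω)) := by
  intro i j
  have hm (i : Fin d) : Measurable fun ω => x ω i := (measurable_pi_apply i).comp hmeas
  refine Integrable.mono' (hx4.add (integrable_const (1 : ℝ)))
    ((hm i).mul (hm j)).aestronglyMeasurable (Filter.Eventually.of_forall fun ω => ?_)
  have := abs_le_s (x ω) i j
  simp only [vecMulVec_apply, Real.norm_eq_abs, Pi.add_apply]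
  nlinarith [sq_nonneg ((∑ i, x ω i ^ 2) - 1)]

lemma entInt_XCX (x : Ω → Fin d → ℝ) (hmeas : Measurable x)
    (hx4 : Integrable (fun ω => (∑ i, x ω i ^ 2) ^ 2) μ) (C : Matrix (Fin d) (Fin d) ℝ) :
    EntInt μ (fun ω => vecMulVec (x ω) (x ω) * C * vecMulVec (x ω) (x ω)) := by
  intro i j
  have hm (i : Fin d) : Measurable fun ω => x ω i := (measurable_pi_apply i).comp hmeas
  simp only [Matrix.mul_apply, vecMulVec_apply, Finset.sum_mul]
  refine integrable_finsetSum _ fun k _ => integrable_finsetSum _ fun l _ => ?_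
  have h : Integrable (fun ω => (x ω i * x ω l) * (x ω k * x ω j)) μ := by
    refine Integrable.mono' hx4
      (((hm i).mul (hm l)).mul ((hm k).mul (hm j))).aestronglyMeasurable
      (Filter.Eventually.of_forall fun ω => ?_)
    rw [Real.norm_eq_abs, abs_mul, sq]
    exact mul_le_mul (abs_le_s _ _ _) (abs_le_s _ _ _) (abs_nonneg _)
      (Finset.sum_nonneg fun i _ => sq_nonneg _)
  refine (h.const_mul (C l k)).congr (Filter.Eventually.of_forall fun ω => ?_)
  simp only
  ring

lemma conj_psd {A B : Matrix (Fin d) (Fin d) ℝ} (hA : A.PosSemidef) (hB : B.IsHermitian) :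
    (B * A * B).PosSemidef := by
  have := hA.mul_mul_conjTranspose_same B
  rwa [hB.eq] at this

lemma step [IsProbabilityMeasure μ] (x : Ω → Fin d → ℝ) (hmeas : Measurable x)
    (hx4 : Integrable (fun ω => (∑ i, x ω i ^ 2) ^ 2) μ) (C H : Matrix (Fin d) (Fin d) ℝ)
    (hH : H = expMatrix μ fun ω => vecMulVec (x ω) (x ω)) (hHh : H.IsHermitian)
    (hC : C.PosSemidef) (η : ℝ) :
    ∃ Q : Matrix (Fin d) (Fin d) ℝ, Q.PosSemidef ∧
      expMatrix μ (fun ω =>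
          (1 - η • vecMulVec (x ω) (x ω)) * C * (1 - η • vecMulVec (x ω) (x ω)))
        = (1 - η • H) * C * (1 - η • H) + Q := by
  have hX := entInt_X x hmeas hx4
  have hXCX := entInt_XCX x hmeas hx4 C
  set X : Ω → Matrix (Fin d) (Fin d) ℝ := fun ω => vecMulVec (x ω) (x ω) with hXdef
  have hXC : EntInt μ (fun ω => X ω * C) := hX.mulRight C
  have hCX : EntInt μ (fun ω => C * X ω) := hX.mulLeft C
  have e1 : expMatrix μ (fun ω => (1 - η • X ω) * C * (1 - η • X ω))
      = C - η • (H * C) - η • (C * H) + (η ^ 2) • expMatrix μ (fun ω => X ω * C * X ω) := by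
    have : (fun ω => (1 - η • X ω) * C * (1 - η • X ω)) =
        fun ω => C - η • (X ω * C) - η • (C * X ω) + (η ^ 2) • (X ω * C * X ω) := by
      funext ω
      simp only [sub_mul, mul_sub, one_mul, mul_one, smul_mul_assoc, mul_smul_comm, smul_sub,
        smul_smul, sq]
      abel
    rw [this, exp_add (((EntInt.const C).sub' (hXC.smul' η)).sub' (hCX.smul' η))
      (hXCX.smul' _), exp_sub ((EntInt.const C).sub' (hXC.smul' η)) (hCX.smul' η),
      exp_sub (EntInt.const C) (hXC.smul' η), exp_const, exp_smul, exp_smul, exp_smul,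
      exp_mulRight C hX, exp_mulLeft C hX, ← hH]
  have i1 : EntInt μ (fun ω => X ω * (C * H)) := hX.mulRight _
  have i2 : EntInt μ (fun ω => H * C * X ω) := hX.mulLeft _
  have this2 : (fun ω => (X ω - H) * C * (X ω - H)) =
        fun ω => X ω * C * X ω - X ω * (C * H) - H * C * X ω + H * C * H := by
    funext ω
    noncomm_ring
  have e2 : expMatrix μ (fun ω => (X ω - H) * C * (X ω - H))
      = expMatrix μ (fun ω => X ω * C * X ω) - H * C * H := by
    rw [this2, exp_add ((hXCX.sub' i1).sub' i2) (EntInt.const _), exp_sub (hXCX.sub' i1) i2,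
      exp_sub hXCX i1, exp_const, exp_mulRight _ hX, exp_mulLeft _ hX, ← hH]
    noncomm_ring
  have hp : (expMatrix μ (fun ω => (X ω - H) * C * (X ω - H))).PosSemidef := by
    apply exp_psd
    · rw [this2]
      exact ((hXCX.sub' i1).sub' i2).add' (EntInt.const _)
    · intro ω
      refine conj_psd hC (Matrix.IsHermitian.sub ?_ hHh)
      ext i j
      simp [hXdef, vecMulVec_apply, mul_comm]
  refine ⟨_, hp.smul (sq_nonneg η), ?_⟩
  rw [e1, e2]
  simp only [sub_mul, mul_sub, one_mul, mul_one, smul_mul_assoc, mul_smul_comm, smul_sub,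
        smul_smul, sq]
  abel

end aux

/-- For the single-task variance-iterate recursion
`C₀ = 0`, `C_{t+1} = E[(I − η x xᵀ) C_t (I − η x xᵀ)] + η² σ² H`, with
`η · λ_max(H) ≤ 1`: `C_N ⪰ (η σ²/2) (I − (I − ηH)^{2N})`. -/
theorem single_task_variance_lower {d : ℕ} {Ω : Type*} [MeasurableSpace Ω]
    (μ : Measure Ω) [IsProbabilityMeasure μ]
    (x : Ω → Fin d → ℝ) (hmeas : Measurable x)
    (hx4 : Integrable (fun ω => (∑ i, x ω i ^ 2) ^ 2) μ)
    (H : Matrix (Fin d) (Fin d) ℝ)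
    (hH : H = expMatrix μ fun ω => vecMulVec (x ω) (x ω))
    (hHpsd : H.PosSemidef)
    (η : ℝ) (hη0 : 0 < η) (lamMax : ℝ)
    (hlam : IsGreatest (Set.range hHpsd.isHermitian.eigenvalues) lamMax)
    (heta_lam : η * lamMax ≤ 1)
    (σ : ℝ) (hσ : 0 ≤ σ) (N : ℕ) (hN : 1 ≤ N)
    (C : ℕ → Matrix (Fin d) (Fin d) ℝ) (hC0 : C 0 = 0)
    (hCrec : ∀ t < N,
      C (t + 1) =
        expMatrix μ (fun ω =>
          (1 - η • vecMulVec (x ω) (x ω)) * C t * (1 - η • vecMulVec (x ω) (x ω)))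
        + (η ^ 2 * σ ^ 2) • H) :
    (C N - (η * σ ^ 2 / 2) • (1 - (1 - η • H) ^ (2 * N))).PosSemidef := by
  have hHh := hHpsd.isHermitian
  set A := 1 - η • H with hA
  have hAh : A.IsHermitian := by
    refine Matrix.isHermitian_one.sub ?_
    ext i j
    have := hHh.apply i j
    simp only [star_trivial] at this
    simp [this]
  have hHH : (H * H).PosSemidef := by
    have := Matrix.posSemidef_self_mul_conjTranspose H
    rwa [hHh.eq] at this
  have key : ∀ t ≤ N, (C t).PosSemidef ∧
      (C t - (η * σ ^ 2 / 2) • (1 - A ^ (2 * t))).PosSemidef := by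
    intro t
    induction t with
    | zero =>
      intro _
      simp [hC0, Matrix.PosSemidef.zero]
    | succ t ih =>
      intro ht
      obtain ⟨h1, h2⟩ := ih (by omega)
      obtain ⟨Q, hQ, hE⟩ := step x hmeas hx4 (C t) H hH hHh h1 η
      rw [hCrec t (by omega), hE, ← hA]
      refine ⟨((conj_psd h1 hAh).add hQ).add (hHpsd.smul (by positivity)), ?_⟩
      have e : A * C t * A + Q + (η ^ 2 * σ ^ 2) • H
          - (η * σ ^ 2 / 2) • (1 - A ^ (2 * (t + 1)))
          = A * (C t - (η * σ ^ 2 / 2) • (1 - A ^ (2 * t))) * A + Q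
            + (η ^ 3 * σ ^ 2 / 2) • (H * H) := by
        have e1 : A ^ (2 * (t + 1)) = A * A ^ (2 * t) * A := by
          rw [← pow_succ', ← pow_succ]
          congr 1
        have e2 : A * A = 1 - (2 * η) • H + (η ^ 2) • (H * H) := by
          rw [hA]
          simp only [sub_mul, mul_sub, one_mul, mul_one, smul_mul_assoc, mul_smul_comm]
          module
        rw [e1]
        simp only [sub_mul, mul_sub, mul_one, smul_mul_assoc, mul_smul_comm]
        rw [e2]
        module
      rw [e]
      exact ((conj_psd h2 hAh).add hQ).add (hHH.smul (by positivity))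
  exact (key N le_rfl).2
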